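/- Suppose a mechanism satisfies ξ-Maximum Bayesian Privacy with respect to a prior f_D: e^{-ξ} ≤ f_{D|W}(d|w)/f_D(d) ≤ e^{ξ} for all d, w. Then for any two datasets d₁, d₂ and any output w, the likelihood ratio satisfies f_{W|D}(w|d₁)/f_{W|D}(w|d₂) ≤ e^{2ξ}; that is, ξ-MBP implies 2ξ-local differential privacy. -/

import Mathlib

open Real

/-- ξ-Maximum Bayesian Privacy implies 2ξ-local differential
privacy on the likelihood, via Bayes' rule. -/
theorem ldp_of_mbp
    {Dty Ω : Type*}
    (fD : Dty → ℝ) (fW : Ω → ℝ) (like : Ω → Dty → ℝ) (post : Dty → Ω → ℝ)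
    (ξ : ℝ)
    (hfD : ∀ d, 0 < fD d) (hfW : ∀ w, 0 < fW w) (hlike : ∀ w d, 0 < like w d)
    (hBayes : ∀ d w, post d w = like w d * fD d / fW w)
    (hMBP : ∀ d w, Real.exp (-ξ) ≤ post d w / fD d ∧ post d w / fD d ≤ Real.exp ξ) :
    ∀ (d₁ d₂ : Dty) (w : Ω), like w d₁ / like w d₂ ≤ Real.exp (2 * ξ) := by
  intro d₁ d₂ w
  have key : ∀ d, post d w / fD d = like w d / fW w := by
    intro d
    have h1 := (hfD d).ne'
    have h2 := (hfW w).ne'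
    rw [hBayes]
    field_simp
  have hu : like w d₁ ≤ Real.exp ξ * fW w := by
    have h := (hMBP d₁ w).2
    rwa [key, div_le_iff₀ (hfW w)] at h
  have hl : Real.exp (-ξ) * fW w ≤ like w d₂ := by
    have h := (hMBP d₂ w).1
    rwa [key, le_div_iff₀ (hfW w)] at h
  rw [div_le_iff₀ (hlike w d₂)]
  have he : Real.exp (2 * ξ) * Real.exp (-ξ) = Real.exp ξ := by
    rw [← Real.exp_add]
    congr 1
    ring
  calc like w d₁ ≤ Real.exp ξ * fW w := hu
    _ = Real.exp (2 * ξ) * (Real.exp (-ξ) * fW w) := by rw [← mul_assoc, he]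
    _ ≤ Real.exp (2 * ξ) * like w d₂ :=
        mul_le_mul_of_nonneg_left hl (Real.exp_pos _).le
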